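/- If there exist a linear RNN of hidden size n and depth L and a linear map w : ℝ^n → ℝ such that w(h_t^(L)) = f_p(x_1,…,x_t) for every input sequence and every time step t, then p ≤ L(n − 1). -/

import Mathlib

open Matrix

noncomputable section

/-- Extend a finite input sequence (0-indexed: entry `t` is the paper's `x_{t+1}`)
to an infinite one by zero. -/
def extSeq {d T : ℕ} (x : Fin T → Fin d → ℝ) : ℕ → Fin d → ℝ :=
  fun t => if h : t < T then x ⟨t, h⟩ else 0

/-- A linear RNN of input dimension `d` and hidden size `n` (with ℕ-indexed layer
parameters; a network of depth `L` only uses the parameters of layers `0,…,L-1`).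
Layer `0` (the paper's layer 1) reads the `d`-dimensional input through `U0`;
layer `l ≥ 1` reads the previous layer's output through `U l`. -/
structure LinRNN (d n : ℕ) where
  h0 : ℕ → Fin n → ℝ
  U0 : Matrix (Fin n) (Fin d) ℝ
  U : ℕ → Matrix (Fin n) (Fin n) ℝ
  V : ℕ → Matrix (Fin n) (Fin n) ℝ
  b : ℕ → Fin n → ℝ

/-- `net.state x l t` is the hidden state `h_t^{(l+1)}` (layer `l` 0-indexed, time `t`
with `t = 0` the initial state); the input at paper-time `t` is `x (t-1)`. -/
def LinRNN.state {d n : ℕ} (net : LinRNN d n) (x : ℕ → Fin d → ℝ) : ℕ → ℕ → Fin n → ℝ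
  | 0, 0 => net.h0 0
  | 0, t + 1 => net.V 0 *ᵥ LinRNN.state net x 0 t + net.U0 *ᵥ x t + net.b 0
  | l + 1, 0 => net.h0 (l + 1)
  | l + 1, t + 1 =>
      net.V (l + 1) *ᵥ LinRNN.state net x (l + 1) t
        + net.U (l + 1) *ᵥ LinRNN.state net x l (t + 1) + net.b (l + 1)
  termination_by l t => (l, t)

/-- `H^RNN_{n,L}`: the sequence-to-sequence functions (defined for every length `T`)
computed (at the last layer) by some linear RNN of hidden size `n` and depth `L`. -/
def RNNclass (d n L : ℕ) : Set ((T : ℕ) → (Fin T → Fin d → ℝ) → Fin T → Fin n → ℝ) :=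
  { f | ∃ net : LinRNN d n, ∀ (T : ℕ) (x : Fin T → Fin d → ℝ) (t : Fin T),
      f T x t = net.state (extSeq x) (L - 1) ((t : ℕ) + 1) }

/-- The copy function `f_p`: at (paper) time `t` (here the 0-indexed `t : Fin T`,
paper time `t+1`) it returns the first component of the input `p` steps earlier,
and `0` if that time is not positive. -/
def fp {d : ℕ} (hd : 0 < d) (p : ℕ) {T : ℕ} (x : Fin T → Fin d → ℝ) (t : Fin T) : ℝ :=
  if p ≤ (t : ℕ) then x ⟨(t : ℕ) - p, lt_of_le_of_lt (Nat.sub_le _ _) t.isLt⟩ ⟨0, hd⟩ else 0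

/-- The family of power series `a` is rational with common denominator of constant
coefficient `1` and numerators of degree at most `k`. -/
def HasRationalForm {ι : Type*} (k : ℕ) (a : ι → PowerSeries ℝ) : Prop :=
  ∃ q : Polynomial ℝ, q.coeff 0 = 1 ∧
    ∀ i, ∃ r : Polynomial ℝ, r.natDegree ≤ k ∧ (q : PowerSeries ℝ) * a i = r

/-- Constant-coefficient linear combinations do not increase the degree of the numerators. -/
theorem HasRationalForm.const_mulVec {ι κ : Type*} [Fintype κ] {k : ℕ}
    {a : κ → PowerSeries ℝ} (ha : HasRationalForm k a) (U : ι → κ → ℝ) :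
    HasRationalForm k (fun i => ∑ j, PowerSeries.C (U i j) * a j) := by
  obtain ⟨q, hq, hr⟩ := ha
  choose r hrd hr using hr
  refine ⟨q, hq, fun i => ⟨∑ j, Polynomial.C (U i j) * r j, ?_, ?_⟩⟩
  · exact Polynomial.natDegree_sum_le_of_forall_le _ _
      fun j _ => (Polynomial.natDegree_C_mul_le _ _).trans (hrd j)
  · rw [Finset.mul_sum, ← Polynomial.coeToPowerSeries.ringHom_apply (φ := ∑ j, _), map_sum]
    refine Finset.sum_congr rfl fun j _ => ?_
    rw [map_mul, Polynomial.coeToPowerSeries.ringHom_apply,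
      Polynomial.coeToPowerSeries.ringHom_apply, Polynomial.coe_C, ← hr]
    ring

open Polynomial in
/-- The entries of the adjugate of `X • A + B` have degree at most `n - 1`. -/
theorem natDegree_adjugate_X_add_C_le {n : ℕ} (A B : Matrix (Fin n) (Fin n) ℝ) (i j : Fin n) :
    (((X : ℝ[X]) • A.map C + B.map C).adjugate i j).natDegree ≤ n - 1 := by
  cases n with
  | zero => exact i.elim0
  | succ m =>
    rw [adjugate_fin_succ_eq_det_submatrix]
    have hdet := natDegree_det_X_add_C_le (A.submatrix j.succAbove i.succAbove)
      (B.submatrix j.succAbove i.succAbove)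
    rw [Fintype.card_fin] at hdet
    have hsign : ((-1 : ℝ[X]) ^ (j + i : ℕ)) = C ((-1) ^ (j + i : ℕ)) := by simp
    rw [hsign]
    exact (natDegree_C_mul_le _ _).trans hdet

open Polynomial in
/-- Solving `a = X V a + c` raises the degree of the numerators by at most `n - 1`. -/
theorem HasRationalForm.of_recurrence {n k : ℕ} {a c : Fin n → PowerSeries ℝ}
    (hc : HasRationalForm k c) (V : Matrix (Fin n) (Fin n) ℝ)
    (h : ∀ i, a i = PowerSeries.X * (∑ j, PowerSeries.C (V i j) * a j) + c i) :
    HasRationalForm (k + (n - 1)) a := by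
  obtain ⟨q, hq, hr⟩ := hc
  choose r hrd hr using hr
  set M : Matrix (Fin n) (Fin n) ℝ[X] := (X : ℝ[X]) • (-V).map C + (1 : Matrix _ _ ℝ).map C
    with hM
  set φ := coeToPowerSeries.ringHom (R := ℝ) with hφ
  have hMa : φ.mapMatrix M *ᵥ a = c := by
    ext1 i
    have hentry : ∀ j, φ (M i j) = (1 : Matrix (Fin n) (Fin n) (PowerSeries ℝ)) i j
        - PowerSeries.X * PowerSeries.C (V i j) := by
      intro j
      by_cases hij : i = j
      · subst hij
        simp [hM, hφ]
        ring
      · simp [hM, hφ, hij]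
        exact mul_comm _ _
    have hci : c i = a i - PowerSeries.X * (∑ j, PowerSeries.C (V i j) * a j) :=
      eq_sub_of_add_eq' (h i).symm
    have hone := congrFun (Matrix.one_mulVec a) i
    simp only [mulVec, dotProduct] at hone
    simp only [mulVec, dotProduct, RingHom.mapMatrix_apply, Matrix.map_apply, hentry, sub_mul,
      Finset.sum_sub_distrib, hci, Finset.mul_sum, mul_assoc, hone]
  have hdet : φ M.det • a = (φ.mapMatrix M.adjugate) *ᵥ c := by
    rw [← hMa, mulVec_mulVec, RingHom.map_adjugate, adjugate_mul, RingHom.map_det, smul_mulVec,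
      one_mulVec]
  refine ⟨q * M.det, ?_, fun i => ⟨∑ j, M.adjugate i j * r j, ?_, ?_⟩⟩
  · rw [mul_coeff_zero, hq, hM, coeff_det_X_add_C_zero, det_one, one_mul]
  · refine natDegree_sum_le_of_forall_le _ _ fun j _ => natDegree_mul_le.trans ?_
    have : (M.adjugate i j).natDegree ≤ n - 1 := natDegree_adjugate_X_add_C_le (-V) 1 i j
    have := hrd j
    omega
  · have hi := congrFun hdet i
    simp only [Pi.smul_apply, smul_eq_mul, mulVec, dotProduct, RingHom.mapMatrix_apply,
      Matrix.map_apply] at hi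
    rw [← coeToPowerSeries.ringHom_apply, ← coeToPowerSeries.ringHom_apply, map_mul, ← hφ,
      mul_assoc, hi, map_sum, Finset.mul_sum]
    refine Finset.sum_congr rfl fun j _ => ?_
    rw [map_mul, hφ, coeToPowerSeries.ringHom_apply, coeToPowerSeries.ringHom_apply,
      coeToPowerSeries.ringHom_apply, ← hr]
    ring

/-- The input sequence whose only nonzero entry is the vector `v` at time `0`. -/
def impulse {d : ℕ} (v : Fin d → ℝ) : ℕ → Fin d → ℝ := Pi.single 0 v

/-- The generating function of the response of layer `l` to an impulse. -/
def LinRNN.impulseResponse {d n : ℕ} (net : LinRNN d n) (v : Fin d → ℝ) (l : ℕ) (i : Fin n) :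
    PowerSeries ℝ :=
  PowerSeries.mk fun t => (net.state (impulse v) l (t + 1) - net.state 0 l (t + 1)) i

theorem LinRNN.state_zero_right {d n : ℕ} (net : LinRNN d n) (x : ℕ → Fin d → ℝ) (l : ℕ) :
    net.state x l 0 = net.h0 l := by
  cases l <;> rw [LinRNN.state]

theorem LinRNN.state_zero_succ {d n : ℕ} (net : LinRNN d n) (x : ℕ → Fin d → ℝ) (t : ℕ) :
    net.state x 0 (t + 1) = net.V 0 *ᵥ net.state x 0 t + net.U0 *ᵥ x t + net.b 0 := by
  rw [LinRNN.state]

theorem LinRNN.state_succ_succ {d n : ℕ} (net : LinRNN d n) (x : ℕ → Fin d → ℝ) (l t : ℕ) :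
    net.state x (l + 1) (t + 1) = net.V (l + 1) *ᵥ net.state x (l + 1) t
      + net.U (l + 1) *ᵥ net.state x l (t + 1) + net.b (l + 1) := by
  rw [LinRNN.state]

theorem Matrix.sum_mul_sub_apply {n : ℕ} (M : Matrix (Fin n) (Fin n) ℝ) (y z : Fin n → ℝ)
    (i : Fin n) : ∑ j, M i j * (y - z) j = (M *ᵥ y) i - (M *ᵥ z) i :=
  congrFun (mulVec_sub M y z) i

theorem LinRNN.impulseResponse_zero {d n : ℕ} (net : LinRNN d n) (v : Fin d → ℝ) (i : Fin n) :
    net.impulseResponse v 0 i =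
      PowerSeries.X * (∑ j, PowerSeries.C (net.V 0 i j) * net.impulseResponse v 0 j)
        + PowerSeries.C ((net.U0 *ᵥ v) i) := by
  ext t
  cases t with
  | zero =>
    simp [impulseResponse, state_zero_succ, state_zero_right, impulse]
  | succ t =>
    rw [map_add, PowerSeries.coeff_succ_X_mul, PowerSeries.coeff_C, if_neg t.succ_ne_zero,
      map_sum]
    simp only [impulseResponse, PowerSeries.coeff_mk, PowerSeries.coeff_C_mul, sum_mul_sub_apply]
    rw [state_zero_succ net _ (t + 1), state_zero_succ net _ (t + 1)]
    simp [impulse]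

theorem LinRNN.impulseResponse_succ {d n : ℕ} (net : LinRNN d n) (v : Fin d → ℝ) (l : ℕ)
    (i : Fin n) :
    net.impulseResponse v (l + 1) i =
      PowerSeries.X * (∑ j, PowerSeries.C (net.V (l + 1) i j) * net.impulseResponse v (l + 1) j)
        + ∑ j, PowerSeries.C (net.U (l + 1) i j) * net.impulseResponse v l j := by
  ext t
  cases t with
  | zero =>
    rw [map_add, PowerSeries.coeff_zero_X_mul, map_sum]
    simp only [impulseResponse, PowerSeries.coeff_mk, PowerSeries.coeff_C_mul, sum_mul_sub_apply]
    rw [state_succ_succ, state_succ_succ, state_zero_right, state_zero_right]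
    simp only [Pi.sub_apply, Pi.add_apply]
    ring
  | succ t =>
    rw [map_add, PowerSeries.coeff_succ_X_mul, map_sum, map_sum]
    simp only [impulseResponse, PowerSeries.coeff_mk, PowerSeries.coeff_C_mul, sum_mul_sub_apply]
    rw [state_succ_succ net _ l (t + 1), state_succ_succ net _ l (t + 1)]
    simp only [Pi.sub_apply, Pi.add_apply]
    ring

theorem LinRNN.hasRationalForm_impulseResponse {d n : ℕ} (net : LinRNN d n) (v : Fin d → ℝ)
    (l : ℕ) : HasRationalForm ((l + 1) * (n - 1)) (net.impulseResponse v l) := by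
  induction l with
  | zero =>
    have hconst : HasRationalForm 0 fun i => PowerSeries.C ((net.U0 *ᵥ v) i) :=
      ⟨1, by simp, fun i => ⟨Polynomial.C ((net.U0 *ᵥ v) i), by simp, by simp⟩⟩
    simpa using hconst.of_recurrence (net.V 0) (net.impulseResponse_zero v)
  | succ l ih =>
    rw [add_mul (l + 1), one_mul]
    exact (ih.const_mulVec (net.U (l + 1))).of_recurrence (net.V (l + 1))
      (net.impulseResponse_succ v l)

theorem extSeq_single {d T : ℕ} (v : Fin d → ℝ) :
    extSeq (Pi.single (0 : Fin (T + 1)) v) = impulse v := by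
  funext s
  by_cases hs : s = 0
  · subst hs
    simp [extSeq, impulse]
  · simp [extSeq, impulse, hs, Fin.ext_iff]

theorem extSeq_zero {d T : ℕ} : extSeq (0 : Fin T → Fin d → ℝ) = 0 := by
  funext s
  simp [extSeq]

/-- If some linear RNN of hidden size `n` and depth `L` together with
a linear readout `w : ℝ^n → ℝ` computes `f_p` on every input sequence at every time
step, then `p ≤ L(n-1)`. -/
theorem lag_le_depth_mul_width (d n L p : ℕ) (hd : 0 < d) (hL : 1 ≤ L) (hp : 1 ≤ p)
    (h : ∃ (net : LinRNN d n) (w : (Fin n → ℝ) →ₗ[ℝ] ℝ),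
      ∀ (T : ℕ) (x : Fin T → Fin d → ℝ) (t : Fin T),
        w (net.state (extSeq x) (L - 1) ((t : ℕ) + 1)) = fp hd p x t) :
    p ≤ L * (n - 1) := by
  obtain ⟨net, w, h⟩ := h
  set e : Fin d → ℝ := Pi.single ⟨0, hd⟩ 1 with he
  have hresp (t : ℕ) : w (net.state (impulse e) (L - 1) (t + 1) - net.state 0 (L - 1) (t + 1))
      = if t = p then 1 else 0 := by
    have h1 := h (t + 1) (Pi.single 0 e) (Fin.last t)
    have h2 := h (t + 1) 0 (Fin.last t)
    rw [extSeq_single] at h1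
    rw [extSeq_zero] at h2
    rw [Fin.val_last] at h1 h2
    rw [map_sub, h1, h2]
    by_cases hpt : p ≤ t
    · by_cases htp : t = p
      · subst htp
        simp [fp, he]
      · have : t - p ≠ 0 := by omega
        simp [fp, hpt, htp, Fin.ext_iff, this]
    · have : t ≠ p := by omega
      simp [fp, hpt, this]
  obtain ⟨q, hq, hr⟩ := (net.hasRationalForm_impulseResponse e (L - 1)).const_mulVec
    (fun (_ : Unit) j => w (Pi.single j 1))
  obtain ⟨r, hrd, hr⟩ := hr ()
  have hX : ∑ j, PowerSeries.C (w (Pi.single j 1)) * net.impulseResponse e (L - 1) j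
      = PowerSeries.X ^ p := by
    ext t
    rw [map_sum, PowerSeries.coeff_X_pow, ← hresp, LinearMap.pi_apply_eq_sum_univ w]
    refine Finset.sum_congr rfl fun j _ => ?_
    rw [PowerSeries.coeff_C_mul, LinRNN.impulseResponse, PowerSeries.coeff_mk, smul_eq_mul,
      mul_comm]
    congr 2
    funext k
    simp [Pi.single_apply, eq_comm]
  rw [hX] at hr
  have hcoeff : r.coeff p = 1 := by
    rw [← Polynomial.coeff_coe, ← hr]
    simpa [hq] using PowerSeries.coeff_mul_X_pow (q : PowerSeries ℝ) p 0
  have hle := Polynomial.le_natDegree_of_ne_zero (hcoeff.trans_ne one_ne_zero)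
  rw [Nat.sub_add_cancel hL] at hrd
  exact hle.trans hrd

end
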